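/- arXiv:2007.12940 — 2 statements merged into one kernel-verified Lean document; each statement's English description precedes it below -/
import Mathlib

section
/- Let M be an automaton over A = B × C that is sequential up to B, where B and C are finitely generated free monoids. If there exists x ∈ B such that M(x) is infinite, then M contains an ε-cycle, i.e., a path (q_{k_1},(1_B,y_1),q_{k_2}),…,(q_{k_m},(1_B,y_m),q_{k_1}) from some state back to itself whose transition labels all have B-component 1_B and whose signature (1_B, y_1⋯y_m) is not the identity of A. -/
/-- An automaton `M = (Q, I, A, δ, F)`: `Q` a type of states, transitions
`δ ⊆ Q × A × Q` (a finite set), initial states `I` and final states `F`. -/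
structure Automaton (Q A : Type) where
  trans : Set (Q × A × Q)
  trans_fin : trans.Finite
  init : Set Q
  final : Set Q

namespace Automaton

variable {Q A B C : Type}

/-- A path from `q` to `q'`: a list of transitions of `M` with consecutive states. -/
def IsPath (M : Automaton Q A) : Q → List (Q × A × Q) → Q → Prop
  | q, [], q' => q = q'
  | q, t :: ts, q' => t ∈ M.trans ∧ t.1 = q ∧ IsPath M t.2.2 ts q'

/-- The signature of a path: product of its labels. -/
def signature [Monoid A] (p : List (Q × A × Q)) : A :=
  (p.map fun t => t.2.1).prod

/-- The language of `M`: signatures of accepting paths. -/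
def lang [Monoid A] (M : Automaton Q A) : Set A :=
  {a | ∃ q ∈ M.init, ∃ q' ∈ M.final, ∃ p, M.IsPath q p q' ∧ signature p = a}

/-- `M` is sequential: no transition label is a product of two non-identity elements. -/
def Sequential [Monoid A] (M : Automaton Q A) : Prop :=
  ∀ q a₁ a₂ q', (q, a₁ * a₂, q') ∈ M.trans → a₁ = 1 ∨ a₂ = 1

/-- Sequential up to `B`: `(q,(bb',c),q') ∈ δ` implies `b = 1` or `b' = 1`. -/
def SequentialUpTo [Monoid B] [Monoid C] (M : Automaton Q (B × C)) : Prop :=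
  ∀ q b b' c q', (q, (b * b', c), q') ∈ M.trans → b = 1 ∨ b' = 1

/-- Deterministic up to `B`: sequential up to `B`, a unique initial state,
no transition with `B`-component `1`, and `δ ⊆ Q × (B \ {1}) → C × Q`. -/
def DeterministicUpTo [Monoid B] [Monoid C] (M : Automaton Q (B × C)) : Prop :=
  M.SequentialUpTo ∧ (∃ q₀, M.init = {q₀}) ∧
  (∀ q b c q', (q, (b, c), q') ∈ M.trans → b ≠ 1) ∧
  (∀ q b c c'' q' q'', (q, (b, c), q') ∈ M.trans → (q, (b, c''), q'') ∈ M.trans →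
    c = c'' ∧ q' = q'')

/-- `δ̂_C(S,x)`: pairs `(q', y·y')` such that some `(q,y) ∈ S` and some path
from `q` to `q'` has signature `(x,y')`. -/
def deltaHatC [Monoid B] [Monoid C] (M : Automaton Q (B × C)) (S : Set (Q × C)) (x : B) :
    Set (Q × C) :=
  {r | ∃ q y y' p, (q, y) ∈ S ∧ M.IsPath q p r.1 ∧ signature p = (x, y') ∧ r.2 = y * y'}

/-- `M(b)`: the set of `c` with `(b,c)` in the language of `M`. -/
def output [Monoid B] [Monoid C] (M : Automaton Q (B × C)) (b : B) : Set C :=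
  {c | (b, c) ∈ M.lang}

end Automaton

/-- A set of pairs is a partial function. -/
def IsPFun {X Y : Type} (S : Set (X × Y)) : Prop :=
  ∀ x y y', (x, y) ∈ S → (x, y') ∈ S → y = y'

namespace Automaton

section Paths

variable {Q A : Type} {M : Automaton Q A}

theorem isPath_append {p r : List (Q × A × Q)} {q q' : Q} :
    M.IsPath q (p ++ r) q' ↔ ∃ s, M.IsPath q p s ∧ M.IsPath s r q' := by
  induction p generalizing q with
  | nil => simp [IsPath]
  | cons t ts ih => simp [IsPath, ih, and_assoc]

theorem IsPath.target_unique {p : List (Q × A × Q)} {q s s' : Q}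
    (h : M.IsPath q p s) (h' : M.IsPath q p s') : s = s' := by
  induction p generalizing q with
  | nil => exact h.symm.trans h'
  | cons t ts ih => exact ih h.2.2 h'.2.2

theorem IsPath.mem_trans {p : List (Q × A × Q)} {q q' : Q} (h : M.IsPath q p q') :
    ∀ t ∈ p, t ∈ M.trans := by
  induction p generalizing q with
  | nil => simp
  | cons t ts ih => exact List.forall_mem_cons.2 ⟨h.1, ih h.2.2⟩

theorem signature_append [Monoid A] (p r : List (Q × A × Q)) :
    signature (p ++ r) = signature p * signature r := by
  simp [signature]

theorem finite_signature_of_length_le [Monoid A] (M : Automaton Q A) (n : ℕ) :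
    {a | ∃ p : List (Q × A × Q), (∀ t ∈ p, t ∈ M.trans) ∧ p.length ≤ n ∧
      signature p = a}.Finite := by
  have : Finite M.trans := M.trans_fin
  refine ((List.finite_length_le M.trans n).image
    fun l => signature (l.map Subtype.val)).subset ?_
  rintro a ⟨p, hp, hn, rfl⟩
  lift p to List M.trans using hp
  exact ⟨p, by simpa using hn, rfl⟩

end Paths

section FreeMonoid

variable {Q C σ : Type} [Monoid C] {M : Automaton Q (FreeMonoid σ × C)}

theorem fst_eq_one_of_signature_fst_eq_one {p : List (Q × (FreeMonoid σ × C) × Q)}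
    (h : (signature p).1 = 1) : ∀ t ∈ p, t.2.1.1 = 1 := by
  induction p with
  | nil => simp
  | cons t ts ih =>
    have h' : t.2.1.1 * (signature ts).1 = 1 := by simpa [signature] using h
    have hl := congrArg FreeMonoid.length h'
    rw [FreeMonoid.length_mul, FreeMonoid.length_one, Nat.add_eq_zero_iff,
      FreeMonoid.length_eq_zero, FreeMonoid.length_eq_zero] at hl
    exact List.forall_mem_cons.2 ⟨hl.1, ih hl.2⟩

/-- A path that is long compared to the first component of its signature contains a cycle
whose labels all have trivial first component. -/
theorem IsPath.exists_cycle [Fintype Q] {p : List (Q × (FreeMonoid σ × C) × Q)} {q q' : Q}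
    (h : M.IsPath q p q')
    (hlen : ((signature p).1.length + 1) * Fintype.card Q ≤ p.length) :
    ∃ u c v s, p = u ++ (c ++ v) ∧ c ≠ [] ∧ M.IsPath q u s ∧ M.IsPath s c s ∧
      M.IsPath s v q' ∧ ∀ t ∈ c, t.2.1.1 = 1 := by
  have hsplit (i : ℕ) : ∃ s, M.IsPath q (p.take i) s ∧ M.IsPath s (p.drop i) q' :=
    isPath_append.1 (by rwa [List.take_append_drop])
  choose s hs hs' using hsplit
  have hlt (i : ℕ) : (signature (p.take i)).1.length < (signature p).1.length + 1 := by
    conv_rhs => rw [← List.take_append_drop i p, signature_append]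
    rw [Prod.fst_mul, FreeMonoid.length_mul]
    omega
  obtain ⟨i, j, hij, he⟩ := Fintype.exists_ne_map_eq_of_card_lt
    (fun i : Fin (p.length + 1) =>
      ((⟨_, hlt i⟩, s i) : Fin ((signature p).1.length + 1) × Q))
    (by simpa using Nat.lt_succ_of_le hlen)
  wlog hlt' : i < j generalizing i j
  · exact this j i hij.symm he.symm (lt_of_le_of_ne (not_lt.1 hlt') hij.symm)
  obtain ⟨hL, hS⟩ : (signature (p.take i)).1.length = (signature (p.take j)).1.length ∧
      s i = s j := by simpa using he
  have hv : (i : ℕ) < j := hlt'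
  have hj : (j : ℕ) ≤ p.length := Nat.le_of_lt_succ j.2
  have htake : p.take j = p.take i ++ (p.take j).drop i := by
    conv_lhs => rw [← List.take_append_drop i (p.take j)]
    rw [List.take_take, min_eq_left hv.le]
  refine ⟨p.take i, (p.take j).drop i, p.drop j, s i, ?_, ?_, hs i, ?_, hS ▸ hs' j, ?_⟩
  · rw [← List.append_assoc, ← htake, List.take_append_drop]
  · intro hnil
    have := congrArg List.length hnil
    simp at this
    omega
  · have hsj := hs j
    rw [htake] at hsj
    obtain ⟨r, hr, hc⟩ := isPath_append.1 hsj
    rw [hr.target_unique (hs i), ← hS] at hc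
    exact hc
  · apply fst_eq_one_of_signature_fst_eq_one
    rw [htake, signature_append, Prod.fst_mul, FreeMonoid.length_mul] at hL
    exact FreeMonoid.length_eq_zero.1 (by omega)

/-- If cycles with trivial first component have trivial signature, every path can be
replaced by one of bounded length with the same signature. -/
theorem IsPath.exists_length_le [Fintype Q]
    (hM : ∀ (q : Q) (p : List (Q × (FreeMonoid σ × C) × Q)),
      p ≠ [] → M.IsPath q p q → (∀ t ∈ p, t.2.1.1 = 1) → signature p = 1)
    {p : List (Q × (FreeMonoid σ × C) × Q)} {q q' : Q} (h : M.IsPath q p q') :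
    ∃ r, M.IsPath q r q' ∧ signature r = signature p ∧
      r.length ≤ ((signature p).1.length + 1) * Fintype.card Q := by
  induction hn : p.length using Nat.strong_induction_on generalizing p with
  | _ n ih =>
    subst hn
    rcases le_total p.length (((signature p).1.length + 1) * Fintype.card Q) with hle | hle
    · exact ⟨p, h, rfl, hle⟩
    · obtain ⟨u, c, v, s, rfl, hc, hu, hcs, hv, h1⟩ := h.exists_cycle hle
      have hsig : signature (u ++ (c ++ v)) = signature (u ++ v) := by
        simp only [signature_append, hM s c hc hcs h1, one_mul]
      rw [hsig]
      refine ih _ ?_ (isPath_append.2 ⟨s, hu, hv⟩) rfl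
      have := List.length_pos_iff.2 hc
      simp only [List.length_append]
      omega

end FreeMonoid

end Automaton

/-- **Infinite superposition.** Let `M` over `A = B × C` be sequential up to
`B`, where `B = Σ₀*` and `C = Γ*` are finitely generated free monoids. If
`M(x)` is infinite for some `x ∈ B`, then `M` contains an ε-cycle: a nonempty
path from some state back to itself all of whose labels have `B`-component
`1_B`, and whose signature is not the identity of `A`. -/
theorem infinite_superposition {Q σ γ : Type} [Fintype Q] [Fintype σ] [Fintype γ]
    (M : Automaton Q (FreeMonoid σ × FreeMonoid γ))
    (hseq : M.SequentialUpTo)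
    (x : FreeMonoid σ) (hinf : (M.output x).Infinite) :
    ∃ (q : Q) (p : List (Q × (FreeMonoid σ × FreeMonoid γ) × Q)),
      p ≠ [] ∧ M.IsPath q p q ∧ (∀ t ∈ p, t.2.1.1 = 1) ∧
      Automaton.signature p ≠ 1 := by
  by_contra! hM
  refine hinf (((M.finite_signature_of_length_le
    ((x.length + 1) * Fintype.card Q)).image Prod.snd).subset ?_)
  rintro c ⟨q, -, q', -, p, hp, hsig⟩
  obtain ⟨r, hr, hrs, hlen⟩ := hp.exists_length_le hM
  rw [hsig] at hrs hlen
  exact ⟨(x, c), ⟨r, hr.mem_trans, hlen, hrs⟩, rfl⟩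
end

section
/- Let M be a lexicographic transducer over A = W* × Σ* × D. Then there exists a finite automaton N over Σ* × D (with no weight tape) whose recognized language L(N) equals min_{D→W*} L(M)\W*. -/
/-- Right-to-left lexicographic (strict) order on strings over a totally
ordered alphabet `W`: `b₁ < b₂` iff the reversals compare lexicographically. -/
def RtlLt {W : Type} [LinearOrder W] (b₁ b₂ : FreeMonoid W) : Prop :=
  List.Lex (· < ·) (FreeMonoid.toList b₁).reverse (FreeMonoid.toList b₂).reverse

/-- Non-strict right-to-left lexicographic order. -/
def RtlLe {W : Type} [LinearOrder W] (b₁ b₂ : FreeMonoid W) : Prop :=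
  b₁ = b₂ ∨ RtlLt b₁ b₂

variable {Q W α D : Type}

/-- A lexicographic transducer: an automaton over `W* × Σ* × D` each of whose
transitions carries exactly one letter on the weight tape and one letter on
the input tape, i.e. `δ ⊆ Q × W × Σ × D × Q`. -/
def IsLexTransducer (M : Automaton Q (FreeMonoid W × FreeMonoid α × D)) : Prop :=
  ∀ t ∈ M.trans, (FreeMonoid.toList t.2.1.1).length = 1 ∧
    (FreeMonoid.toList t.2.1.2.1).length = 1

/-- `M(c)`: pairs `(b,d)` with `(b,c,d)` in the language of `M`. -/
def lexOut [Monoid D] (M : Automaton Q (FreeMonoid W × FreeMonoid α × D))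
    (c : FreeMonoid α) : Set (FreeMonoid W × D) :=
  {bd | (bd.1, c, bd.2) ∈ M.lang}

/-- The quotient `M(c)\W*`: `(d,b)` with `b` the (right-to-left lexicographic)
minimum of `{b' : (b',d) ∈ M(c)}`. -/
def lexQuot [LinearOrder W] [Monoid D] (M : Automaton Q (FreeMonoid W × FreeMonoid α × D))
    (c : FreeMonoid α) : Set (D × FreeMonoid W) :=
  {db | (db.2, db.1) ∈ lexOut M c ∧ ∀ b', (b', db.1) ∈ lexOut M c → RtlLe db.2 b'}

/-- `min_{D→W*} L(M)\W*`: pairs `(c,d)` such that `(d,b) ∈ M(c)\W*` for some `b`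
with `b ≤ b''` whenever `(d'',b'') ∈ M(c)\W*`. -/
def minRel [LinearOrder W] [Monoid D] (M : Automaton Q (FreeMonoid W × FreeMonoid α × D)) :
    Set (FreeMonoid α × D) :=
  {cd | ∃ b, (cd.2, b) ∈ lexQuot M cd.1 ∧
    ∀ d'' b'', (d'', b'') ∈ lexQuot M cd.1 → RtlLe b b''}

/-- The input (`Σ*`) component of the signature of a path. -/
def inputSig (p : List (Q × (FreeMonoid W × FreeMonoid α × D) × Q)) : FreeMonoid α :=
  (p.map fun t => t.2.1.2.1).prod

/-- Strongly functional: exactly one accepting state, and no pair of conflicting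
transitions (distinct sources, same input letter, same weight, same target)
whose source states both occur in a common superposition reachable from the
initial superposition by reading some input string. -/
def StronglyFunctional (M : Automaton Q (FreeMonoid W × FreeMonoid α × D)) : Prop :=
  (∃ qf, M.final = {qf}) ∧
  ¬ ∃ (q₁ q₂ q' : Q) (w : FreeMonoid W) (σ : FreeMonoid α) (d₁ d₂ : D),
      q₁ ≠ q₂ ∧ (q₁, (w, σ, d₁), q') ∈ M.trans ∧ (q₂, (w, σ, d₂), q') ∈ M.trans ∧
      ∃ q₀₁ ∈ M.init, ∃ q₀₂ ∈ M.init, ∃ p₁ p₂,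
        M.IsPath q₀₁ p₁ q₁ ∧ M.IsPath q₀₂ p₂ q₂ ∧ inputSig p₁ = inputSig p₂

namespace Automaton

/-- `M.Reach a q`: some path from an initial state to `q` has signature `a`. -/
inductive Reach {Q A : Type} [Monoid A] (M : Automaton Q A) : A → Q → Prop
  | init {q : Q} (hq : q ∈ M.init) : Reach M 1 q
  | snoc {a x : A} {q q' : Q} (h : Reach M a q) (ht : (q, x, q') ∈ M.trans) :
      Reach M (a * x) q'

theorem Reach.append {Q A : Type} [Monoid A] {M : Automaton Q A}
    (p : List (Q × A × Q)) {a : A} {q q' : Q} (h : M.Reach a q) (hp : M.IsPath q p q') :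
    M.Reach (a * signature p) q' := by
  induction p generalizing a q with
  | nil =>
    cases hp
    simpa [signature] using h
  | cons t ts ih =>
    obtain ⟨s, x, s'⟩ := t
    obtain ⟨ht, rfl, hts⟩ := hp
    simpa [signature, mul_assoc] using ih (h.snoc ht) hts

theorem IsPath.snoc {Q A : Type} {M : Automaton Q A} {p : List (Q × A × Q)} {q r s : Q} {x : A}
    (hp : M.IsPath q p r) (ht : (r, x, s) ∈ M.trans) : M.IsPath q (p ++ [(r, x, s)]) s := by
  induction p generalizing q with
  | nil =>
    cases hp
    exact ⟨ht, rfl, rfl⟩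
  | cons t ts ih => exact ⟨hp.1, hp.2.1, ih hp.2.2⟩

theorem Reach.exists_path {Q A : Type} [Monoid A] {M : Automaton Q A} {a : A} {q : Q}
    (h : M.Reach a q) : ∃ q₀ ∈ M.init, ∃ p, M.IsPath q₀ p q ∧ signature p = a := by
  induction h with
  | init hq => exact ⟨_, hq, [], rfl, rfl⟩
  | snoc _ ht ih =>
    obtain ⟨q₀, hq₀, p, hp, rfl⟩ := ih
    exact ⟨q₀, hq₀, _, hp.snoc ht, by simp [signature]⟩

theorem mem_lang_iff {Q A : Type} [Monoid A] {M : Automaton Q A} {a : A} :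
    a ∈ M.lang ↔ ∃ q ∈ M.final, M.Reach a q := by
  constructor
  · rintro ⟨q₀, hq₀, q, hq, p, hp, rfl⟩
    exact ⟨q, hq, by simpa using (Reach.init hq₀).append p hp⟩
  · rintro ⟨q, hq, h⟩
    obtain ⟨q₀, hq₀, p, hp, rfl⟩ := h.exists_path
    exact ⟨q₀, hq₀, q, hq, p, hp, rfl⟩

end Automaton

theorem rtlLe_iff {W : Type} [LinearOrder W] {b b' : FreeMonoid W} :
    RtlLe b b' ↔ (FreeMonoid.toList b).reverse ≤ (FreeMonoid.toList b').reverse := by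
  rw [le_iff_eq_or_lt, List.reverse_inj]
  rfl

theorem RtlLe.trans {W : Type} [LinearOrder W] {a b c : FreeMonoid W}
    (hab : RtlLe a b) (hbc : RtlLe b c) : RtlLe a c :=
  rtlLe_iff.2 ((rtlLe_iff.1 hab).trans (rtlLe_iff.1 hbc))

theorem rtlLe_mul_iff {W : Type} [LinearOrder W] {b b' w w' : FreeMonoid W}
    (hw : w.toList.length = 1) (hw' : w'.toList.length = 1) :
    RtlLe (b * w) (b' * w') ↔ RtlLt w w' ∨ w = w' ∧ RtlLe b b' := by
  obtain ⟨x, hx⟩ := List.length_eq_one_iff.1 hw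
  obtain ⟨y, hy⟩ := List.length_eq_one_iff.1 hw'
  obtain rfl : w = FreeMonoid.of x := hx
  obtain rfl : w' = FreeMonoid.of y := hy
  have hlt : RtlLt (FreeMonoid.of x) (FreeMonoid.of y) ↔ x < y := by
    simp [RtlLt]
  rw [hlt, rtlLe_iff, rtlLe_iff, FreeMonoid.of_injective.eq_iff]
  simp only [FreeMonoid.toList_mul, FreeMonoid.toList_of, List.reverse_append,
    List.reverse_singleton, List.singleton_append, le_iff_lt_or_eq, List.cons_lt_cons_iff,
    List.cons.injEq]
  tauto

theorem FreeMonoid.mul_inj_of_length_one {α : Type} {c c' s s' : FreeMonoid α}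
    (hs : s.toList.length = 1) (hs' : s'.toList.length = 1) (h : c * s = c' * s') :
    c = c' ∧ s = s' :=
  List.append_inj' (show c.toList ++ s.toList = c'.toList ++ s'.toList from h)
    (hs.trans hs'.symm)

namespace LexTransducer

open Automaton

/-- The weights of the paths that lead from an initial state to `q` reading `c`. -/
def weights [Monoid D] (M : Automaton Q (FreeMonoid W × FreeMonoid α × D))
    (c : FreeMonoid α) (q : Q) : Set (FreeMonoid W) :=
  {b | ∃ d, M.Reach (b, c, d) q}

/-- `b` is a lower bound of the weights of the paths leading to `q` on input `c`. -/
def IsLower [LinearOrder W] [Monoid D] (M : Automaton Q (FreeMonoid W × FreeMonoid α × D))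
    (c : FreeMonoid α) (b : FreeMonoid W) (q : Q) : Prop :=
  ∀ b' ∈ weights M c q, RtlLe b b'

/-- The preorder on reachable states after reading `c`, comparing least weights. -/
def ranking [LinearOrder W] [Monoid D] (M : Automaton Q (FreeMonoid W × FreeMonoid α × D))
    (c : FreeMonoid α) : Set (Q × Q) :=
  {r | (weights M c r.2).Nonempty ∧ ∃ b ∈ weights M c r.1, IsLower M c b r.2}

/-- The weights and sources of the transitions reading `s` into `q'` from ranked states. -/
def candidates (M : Automaton Q (FreeMonoid W × FreeMonoid α × D))
    (P : Set (Q × Q)) (s : FreeMonoid α) (q' : Q) : Set (FreeMonoid W × Q) :=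
  {x | (x.2, x.2) ∈ P ∧ ∃ d, (x.2, (x.1, s, d), q') ∈ M.trans}

/-- Comparison of candidates: first by weight, then by the ranking of the source. -/
def CandLe [LinearOrder W] (P : Set (Q × Q)) (x y : FreeMonoid W × Q) : Prop :=
  RtlLt x.1 y.1 ∨ x.1 = y.1 ∧ (x.2, y.2) ∈ P

/-- The ranking obtained from `P` by reading `s`. -/
def rankingStep [LinearOrder W] (M : Automaton Q (FreeMonoid W × FreeMonoid α × D))
    (P : Set (Q × Q)) (s : FreeMonoid α) : Set (Q × Q) :=
  {r | (candidates M P s r.2).Nonempty ∧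
    ∃ x ∈ candidates M P s r.1, ∀ y ∈ candidates M P s r.2, CandLe P x y}

theorem reach_length [Monoid D] {M : Automaton Q (FreeMonoid W × FreeMonoid α × D)}
    (hM : IsLexTransducer M) {a : FreeMonoid W × FreeMonoid α × D} {q : Q} (h : M.Reach a q) :
    a.1.toList.length = a.2.1.toList.length := by
  induction h with
  | init hq => rfl
  | snoc _ ht ih =>
    have := hM _ ht
    simp_all [FreeMonoid.toList_mul]

theorem finite_length_eq [Finite W] (n : ℕ) :
    {b : FreeMonoid W | b.toList.length = n}.Finite :=
  List.finite_length_eq W n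

theorem exists_isLower [Finite W] [LinearOrder W] [Monoid D]
    {M : Automaton Q (FreeMonoid W × FreeMonoid α × D)} (hM : IsLexTransducer M)
    {c : FreeMonoid α} {q : Q} (h : (weights M c q).Nonempty) :
    ∃ b ∈ weights M c q, IsLower M c b q := by
  have hfin : (weights M c q).Finite :=
    (finite_length_eq c.toList.length).subset fun _ ⟨_, hd⟩ => reach_length hM hd
  obtain ⟨b, hb, hmin⟩ := Set.exists_min_image _ (fun b => b.toList.reverse) hfin h
  exact ⟨b, hb, fun b' hb' => rtlLe_iff.2 (hmin b' hb')⟩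

theorem mem_weights_mul [Monoid D] {M : Automaton Q (FreeMonoid W × FreeMonoid α × D)}
    {c s : FreeMonoid α} {b w : FreeMonoid W} {d : D} {q q' : Q}
    (hb : b ∈ weights M c q) (ht : (q, (w, s, d), q') ∈ M.trans) :
    b * w ∈ weights M (c * s) q' :=
  hb.elim fun _ h => ⟨_, h.snoc ht⟩

theorem exists_of_mem_weights_mul [Monoid D]
    {M : Automaton Q (FreeMonoid W × FreeMonoid α × D)} (hM : IsLexTransducer M)
    {c s : FreeMonoid α} (hs : s.toList.length = 1) {b : FreeMonoid W} {q' : Q}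
    (h : b ∈ weights M (c * s) q') :
    ∃ q b₀ w d, b₀ ∈ weights M c q ∧ (q, (w, s, d), q') ∈ M.trans ∧ b = b₀ * w := by
  obtain ⟨d, h⟩ := h
  generalize ha : (b, c * s, d) = a at h
  cases h with
  | init hq =>
    have h2 : c * s = 1 := congrArg (fun a => a.2.1) ha
    have := congrArg (fun u : FreeMonoid α => u.toList.length) h2
    simp [FreeMonoid.toList_mul, hs] at this
  | @snoc a x q _ h ht =>
    obtain ⟨b₀, c₀, d₀⟩ := a
    obtain ⟨w, s₀, e⟩ := x
    simp only [Prod.mk_mul_mk, Prod.mk.injEq] at ha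
    obtain ⟨rfl, hc, rfl⟩ := ha
    obtain ⟨rfl, rfl⟩ := FreeMonoid.mul_inj_of_length_one hs (hM _ ht).2 hc
    exact ⟨q, b₀, w, e, ⟨d₀, h⟩, ht, rfl⟩

theorem diag_mem_ranking [Finite W] [LinearOrder W] [Monoid D]
    {M : Automaton Q (FreeMonoid W × FreeMonoid α × D)} (hM : IsLexTransducer M)
    {c : FreeMonoid α} {q : Q} : (q, q) ∈ ranking M c ↔ (weights M c q).Nonempty :=
  ⟨fun h => h.1, fun h => ⟨h, exists_isLower hM h⟩⟩

/-- A weight beating every weight into `q'` comes from a candidate beating every candidate. -/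
theorem candLe_of_isLower [Finite W] [LinearOrder W] [Monoid D]
    {M : Automaton Q (FreeMonoid W × FreeMonoid α × D)} (hM : IsLexTransducer M)
    {c s : FreeMonoid α} {b w : FreeMonoid W} (hw : w.toList.length = 1) {q q' : Q}
    (hb : b ∈ weights M c q) (hl : IsLower M (c * s) (b * w) q') :
    ∀ y ∈ candidates M (ranking M c) s q', CandLe (ranking M c) (w, q) y := by
  rintro ⟨w₂, q₂⟩ ⟨hP, e, ht⟩
  obtain ⟨b₂, hb₂, hl₂⟩ := hP.2
  refine ((rtlLe_mul_iff hw (hM _ ht).1).1 (hl _ (mem_weights_mul hb₂ ht))).imp id fun h => ?_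
  exact ⟨h.1, ⟨b₂, hb₂⟩, b, hb, fun b' hb' => h.2.trans (hl₂ b' hb')⟩

theorem isLower_of_candLe [Finite W] [LinearOrder W] [Monoid D]
    {M : Automaton Q (FreeMonoid W × FreeMonoid α × D)} (hM : IsLexTransducer M)
    {c s : FreeMonoid α} (hs : s.toList.length = 1) {b w : FreeMonoid W}
    (hw : w.toList.length = 1) {q q' : Q} (hl : IsLower M c b q)
    (h : ∀ y ∈ candidates M (ranking M c) s q', CandLe (ranking M c) (w, q) y) :
    IsLower M (c * s) (b * w) q' := by
  intro b' hb'
  obtain ⟨q₂, b₂, w₂, e, hb₂, ht, rfl⟩ := exists_of_mem_weights_mul hM hs hb'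
  refine (rtlLe_mul_iff hw (hM _ ht).1).2 ?_
  refine (h (w₂, q₂) ⟨(diag_mem_ranking hM).2 ⟨b₂, hb₂⟩, e, ht⟩).imp id fun hx => ⟨hx.1, ?_⟩
  obtain ⟨-, b₁, hb₁, hl₁⟩ := hx.2
  exact (hl b₁ hb₁).trans (hl₁ b₂ hb₂)

theorem candidates_nonempty_iff [Finite W] [LinearOrder W] [Monoid D]
    {M : Automaton Q (FreeMonoid W × FreeMonoid α × D)} (hM : IsLexTransducer M)
    {c s : FreeMonoid α} (hs : s.toList.length = 1) {q' : Q} :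
    (candidates M (ranking M c) s q').Nonempty ↔ (weights M (c * s) q').Nonempty := by
  constructor
  · rintro ⟨⟨w, q⟩, ⟨⟨b, hb⟩, -⟩, e, ht⟩
    exact ⟨_, mem_weights_mul hb ht⟩
  · rintro ⟨b, hb⟩
    obtain ⟨q, b₀, w, e, hb₀, ht, -⟩ := exists_of_mem_weights_mul hM hs hb
    exact ⟨(w, q), (diag_mem_ranking hM).2 ⟨b₀, hb₀⟩, e, ht⟩

theorem rankingStep_ranking [Finite W] [LinearOrder W] [Monoid D]
    {M : Automaton Q (FreeMonoid W × FreeMonoid α × D)} (hM : IsLexTransducer M)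
    {c s : FreeMonoid α} (hs : s.toList.length = 1) :
    rankingStep M (ranking M c) s = ranking M (c * s) := by
  ext ⟨q₁, q₂⟩
  refine and_congr (candidates_nonempty_iff hM hs) ⟨?_, ?_⟩
  · rintro ⟨⟨w, q⟩, ⟨hP, e, ht⟩, hx⟩
    obtain ⟨b, hb, hl⟩ := hP.2
    exact ⟨_, mem_weights_mul hb ht, isLower_of_candLe hM hs (hM _ ht).1 hl hx⟩
  · rintro ⟨b, hb, hl⟩
    obtain ⟨q, b₀, w, e, hb₀, ht, rfl⟩ := exists_of_mem_weights_mul hM hs hb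
    exact ⟨(w, q), ⟨(diag_mem_ranking hM).2 ⟨b₀, hb₀⟩, e, ht⟩,
      candLe_of_isLower hM (hM _ ht).1 hb₀ hl⟩

/-- The automaton following only least-weight paths of `M`, each state being paired with the
current ranking of the states of `M`. -/
def erase [Finite Q] [LinearOrder W] [Monoid D]
    (M : Automaton Q (FreeMonoid W × FreeMonoid α × D)) :
    Automaton (Q × Set (Q × Q)) (FreeMonoid α × D) where
  trans := (fun x : (Q × (FreeMonoid W × FreeMonoid α × D) × Q) × Set (Q × Q) =>
      ((x.1.1, x.2), x.1.2.1.2, (x.1.2.2, rankingStep M x.2 x.1.2.1.2.1))) ''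
    {x | x.1 ∈ M.trans ∧ ∀ y ∈ candidates M x.2 x.1.2.1.2.1 x.1.2.2,
      CandLe x.2 (x.1.2.1.1, x.1.1) y}
  trans_fin := ((M.trans_fin.prod Set.finite_univ).subset
    fun _ hx => ⟨hx.1, Set.mem_univ _⟩).image _
  init := {r | r.1 ∈ M.init ∧ r.2 = ranking M 1}
  final := {r | r.1 ∈ M.final ∧ ∀ q ∈ M.final, (q, q) ∈ r.2 → (r.1, q) ∈ r.2}

theorem reach_of_reach_erase [Finite Q] [Finite W] [LinearOrder W] [Monoid D]
    {M : Automaton Q (FreeMonoid W × FreeMonoid α × D)} (hM : IsLexTransducer M)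
    {a : FreeMonoid α × D} {r : Q × Set (Q × Q)} (h : (erase M).Reach a r) :
    r.2 = ranking M a.1 ∧ ∃ b, M.Reach (b, a.1, a.2) r.1 ∧ IsLower M a.1 b r.1 := by
  induction h with
  | init hq =>
    refine ⟨hq.2, 1, .init hq.1, ?_⟩
    rintro b' ⟨d, hd⟩
    exact Or.inl (List.eq_nil_of_length_eq_zero (reach_length hM hd)).symm
  | @snoc a x r r' _ ht ih =>
    obtain ⟨q, P⟩ := r
    obtain ⟨rfl, b, hb, hl⟩ := ih
    obtain ⟨⟨⟨q₁, ⟨w, s, e⟩, q'⟩, P⟩, ⟨ht, hbest⟩, heq⟩ := ht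
    simp only [Prod.mk.injEq] at heq
    obtain ⟨⟨rfl, rfl⟩, rfl, rfl⟩ := heq
    have hs := (hM _ ht).2
    exact ⟨rankingStep_ranking hM hs, b * w, hb.snoc ht,
      isLower_of_candLe hM hs (hM _ ht).1 hl hbest⟩

theorem reach_erase_of_reach [Finite Q] [Finite W] [LinearOrder W] [Monoid D]
    {M : Automaton Q (FreeMonoid W × FreeMonoid α × D)} (hM : IsLexTransducer M)
    {a : FreeMonoid W × FreeMonoid α × D} {q : Q} (h : M.Reach a q)
    (hl : IsLower M a.2.1 a.1 q) : (erase M).Reach a.2 (q, ranking M a.2.1) := by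
  induction h with
  | init hq => exact .init ⟨hq, rfl⟩
  | @snoc a x q q' h ht ih =>
    obtain ⟨b, c, d⟩ := a
    obtain ⟨w, s, e⟩ := x
    obtain ⟨hw, hs⟩ := hM _ ht
    have hlb : IsLower M c b q := fun b' hb' =>
      ((rtlLe_mul_iff hw hw).1 (hl _ (mem_weights_mul hb' ht))).elim
        (fun hlt => (lt_irrefl w.toList.reverse hlt).elim) And.right
    refine (ih hlb).snoc (x := (s, e)) ⟨((q, (w, s, e), q'), ranking M c),
      ⟨ht, candLe_of_isLower hM hw ⟨d, h⟩ hl⟩, ?_⟩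
    exact congrArg (fun P => ((q, ranking M c), (s, e), (q', P))) (rankingStep_ranking hM hs)

theorem mem_minRel_iff [Finite W] [LinearOrder W] [Monoid D]
    {M : Automaton Q (FreeMonoid W × FreeMonoid α × D)} (hM : IsLexTransducer M)
    {c : FreeMonoid α} {d : D} :
    (c, d) ∈ minRel M ↔
      ∃ b, (b, c, d) ∈ M.lang ∧ ∀ b' d', (b', c, d') ∈ M.lang → RtlLe b b' := by
  constructor
  · rintro ⟨b, hb, hmin⟩
    refine ⟨b, hb.1, fun b' d' h' => ?_⟩
    have hfin : {b | (b, c, d') ∈ M.lang}.Finite :=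
      (finite_length_eq c.toList.length).subset fun _ h =>
        (mem_lang_iff.1 h).elim fun _ h => reach_length hM h.2
    obtain ⟨b₀, hb₀, hmin₀⟩ := Set.exists_min_image _ (fun b => b.toList.reverse) hfin ⟨b', h'⟩
    exact (hmin d' b₀ ⟨hb₀, fun b₁ h₁ => rtlLe_iff.2 (hmin₀ b₁ h₁)⟩).trans
      (rtlLe_iff.2 (hmin₀ b' h'))
  · rintro ⟨b, hb, hmin⟩
    exact ⟨b, ⟨hb, fun b' h' => hmin b' d h'⟩, fun d' b' h' => hmin b' d' h'.1⟩

theorem lang_erase [Finite Q] [Finite W] [LinearOrder W] [Monoid D]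
    {M : Automaton Q (FreeMonoid W × FreeMonoid α × D)} (hM : IsLexTransducer M) :
    (erase M).lang = minRel M := by
  ext ⟨c, d⟩
  rw [mem_lang_iff, mem_minRel_iff hM]
  constructor
  · rintro ⟨⟨q, P⟩, ⟨hq, hbest⟩, h⟩
    obtain ⟨rfl, b, hb, hl⟩ := reach_of_reach_erase hM h
    refine ⟨b, mem_lang_iff.2 ⟨q, hq, hb⟩, fun b' d' h' => ?_⟩
    obtain ⟨q', hq', h'⟩ := mem_lang_iff.1 h'
    obtain ⟨-, b₁, hb₁, hl₁⟩ := hbest q' hq' ((diag_mem_ranking hM).2 ⟨b', d', h'⟩)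
    exact (hl b₁ hb₁).trans (hl₁ b' ⟨d', h'⟩)
  · rintro ⟨b, hb, hmin⟩
    obtain ⟨q, hq, h⟩ := mem_lang_iff.1 hb
    have hlow : ∀ q' ∈ M.final, IsLower M c b q' := fun q' hq' b' ⟨d', h'⟩ =>
      hmin b' d' (mem_lang_iff.2 ⟨q', hq', h'⟩)
    exact ⟨(q, ranking M c), ⟨hq, fun q' hq' hP => ⟨hP.1, b, ⟨d, h⟩, hlow q' hq'⟩⟩,
      reach_erase_of_reach hM h (hlow q hq)⟩

end LexTransducer

/-- **Weights can be erased.** For every lexicographic transducer `M` over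
`A = W* × Σ* × D` there exists a finite automaton `N` over `Σ* × D` (with no
weight tape) whose language equals `min_{D→W*} L(M)\W*`. -/
theorem weights_can_be_erased {Q W α D : Type} [Fintype Q] [Fintype W]
    [LinearOrder W] [Fintype α] [Monoid D]
    (M : Automaton Q (FreeMonoid W × FreeMonoid α × D)) (hM : IsLexTransducer M) :
    ∃ (Q' : Type) (_ : Fintype Q') (N : Automaton Q' (FreeMonoid α × D)),
      N.lang = minRel M := by
  exact ⟨Q × Set (Q × Q), Fintype.ofFinite _, LexTransducer.erase M, LexTransducer.lang_erase hM⟩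
end
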